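/- Let ω be a weight on ℝ₊ with ω ∈ B_p(0), 1 < p < ∞, and c ∈ ℝ. Then R^0_{p,ω}(c) is a closed subset of D^{1,p}(ℝ₊,ω): if u_n ∈ R^0_{p,ω}(c), u ∈ D^{1,p}(ℝ₊,ω), u_n' → u' in L^p(ℝ₊,ω), and u_n → u uniformly on every compact subset of ℝ₊, then u ∈ R^0_{p,ω}(c). -/

import Mathlib

open MeasureTheory Set Filter Topology
open scoped NNReal ENNReal

noncomputable section

/-- A weight on `ℝ₊ = (0,∞)`: continuous and positive there. -/
def IsWeight (ω : ℝ → ℝ) : Prop :=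
  ContinuousOn ω (Set.Ioi 0) ∧ ∀ t : ℝ, 0 < t → 0 < ω t

/-- Membership of the pair `(u, u')` in the weighted Dirichlet space
`D^{1,p}(ℝ₊, ω)`: `u'` is locally integrable on `(0,∞)`, `u` is locally
absolutely continuous with derivative `u'`, and `∫_0^∞ |u'|^p ω < ∞`. -/
def MemD (p : ℝ) (ω u u' : ℝ → ℝ) : Prop :=
  (∀ a b : ℝ, 0 < a → a < b → IntegrableOn u' (Set.Ioc a b)) ∧
  (∀ a b : ℝ, 0 < a → a < b → u b - u a = ∫ τ in a..b, u' τ) ∧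
  IntegrableOn (fun t => |u' t| ^ p * ω t) (Set.Ioi 0)

/-- `‖u'‖_{L^p(ℝ₊, ω)} = (∫_0^∞ |u'(t)|^p ω(t) dt)^{1/p}`. -/
def dNorm (p : ℝ) (ω u' : ℝ → ℝ) : ℝ :=
  (∫ t in Set.Ioi (0:ℝ), |u' t| ^ p * ω t) ^ (1 / p)

/-- The norm `‖u‖^{(a)} = |u(a)| + ‖u'‖_{L^p(ℝ₊, ω)}`. -/
def aNorm (p : ℝ) (ω : ℝ → ℝ) (a : ℝ) (u u' : ℝ → ℝ) : ℝ :=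
  |u a| + dNorm p ω u'

/-- `ω ∈ B_p(0)`: `∫_0^1 ω(t)^{-1/(p-1)} dt < ∞`. -/
def Bp0 (p : ℝ) (ω : ℝ → ℝ) : Prop :=
  IntegrableOn (fun t => ω t ^ (-1 / (p - 1))) (Set.Ioc (0:ℝ) 1)

/-- `ω ∈ B_p(∞)`: `∫_1^∞ ω(t)^{-1/(p-1)} dt < ∞`. -/
def BpInf (p : ℝ) (ω : ℝ → ℝ) : Prop :=
  IntegrableOn (fun t => ω t ^ (-1 / (p - 1))) (Set.Ioi (1:ℝ))

/-- `Ω^0_ω(t) = (∫_0^t ω(τ)^{-1/(p-1)} dτ)^{1-1/p}`. -/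
def Omega0 (p : ℝ) (ω : ℝ → ℝ) (t : ℝ) : ℝ :=
  (∫ τ in Set.Ioc (0:ℝ) t, ω τ ^ (-1 / (p - 1))) ^ (1 - 1 / p)

/-- `Ω^∞_ω(t) = (∫_t^∞ ω(τ)^{-1/(p-1)} dτ)^{1-1/p}`. -/
def OmegaInf (p : ℝ) (ω : ℝ → ℝ) (t : ℝ) : ℝ :=
  (∫ τ in Set.Ioi t, ω τ ^ (-1 / (p - 1))) ^ (1 - 1 / p)

/-- `R^0_{p,ω}(c)`: elements of `D^{1,p}(ℝ₊,ω)` with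
`u(t) = c + ∫_0^t u'(τ) dτ` for every `t > 0`. -/
def MemR0 (p : ℝ) (ω : ℝ → ℝ) (c : ℝ) (u u' : ℝ → ℝ) : Prop :=
  MemD p ω u u' ∧ ∀ t : ℝ, 0 < t →
    IntegrableOn u' (Set.Ioc 0 t) ∧ u t = c + ∫ τ in Set.Ioc (0:ℝ) t, u' τ

/-- `R^∞_{p,ω}(c)`: elements of `D^{1,p}(ℝ₊,ω)` with
`u(t) = c - ∫_t^∞ u'(τ) dτ` for every `t > 0`. -/
def MemRInf (p : ℝ) (ω : ℝ → ℝ) (c : ℝ) (u u' : ℝ → ℝ) : Prop :=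
  MemD p ω u u' ∧ ∀ t : ℝ, 0 < t →
    IntegrableOn u' (Set.Ioi t) ∧ u t = c - ∫ τ in Set.Ioi t, u' τ

/-- `D_0^{1,p}(ℝ₊,ω)`: elements of `D^{1,p}(ℝ₊,ω)` approximable by smooth
compactly supported functions on `(0,∞)`, with derivatives converging in
`L^p(ℝ₊,ω)` and locally uniform convergence on compact subsets of `(0,∞)`. -/
def MemD0 (p : ℝ) (ω u u' : ℝ → ℝ) : Prop :=
  MemD p ω u u' ∧
  ∃ φ : ℕ → ℝ → ℝ,
    (∀ n, ContDiff ℝ (⊤ : ℕ∞) (φ n) ∧ HasCompactSupport (φ n) ∧ tsupport (φ n) ⊆ Set.Ioi 0) ∧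
    Tendsto (fun n => ∫ t in Set.Ioi (0:ℝ), |deriv (φ n) t - u' t| ^ p * ω t)
      atTop (𝓝 0) ∧
    (∀ K : Set ℝ, K ⊆ Set.Ioi 0 → IsCompact K →
      TendstoUniformlyOn (fun n => φ n) u atTop K)

/-- A function integrable on every `(a, b]` with `0 < a < b` is strongly measurable on `(0, ∞)`. -/
theorem aestronglyMeasurable_Ioi_of_integrableOn_Ioc {f : ℝ → ℝ}
    (hf : ∀ a b : ℝ, 0 < a → a < b → IntegrableOn f (Set.Ioc a b)) :
    AEStronglyMeasurable f (volume.restrict (Set.Ioi 0)) := by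
  have hU : Set.Ioi (0 : ℝ) = ⋃ n : ℕ, Set.Ioc (1 / ((n : ℝ) + 1)) ((n : ℝ) + 2) := by
    ext x
    simp only [Set.mem_Ioi, Set.mem_iUnion, Set.mem_Ioc]
    constructor
    · intro hx
      obtain ⟨n, hn⟩ := exists_nat_one_div_lt hx
      obtain ⟨m, hm⟩ := exists_nat_ge x
      refine ⟨max n m, lt_of_le_of_lt ?_ hn, ?_⟩
      · push_cast
        gcongr
        exact le_max_left _ _
      · push_cast
        linarith [le_max_right (n : ℝ) m]
    · rintro ⟨n, h, -⟩
      exact lt_trans (by positivity) h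
  rw [hU, aestronglyMeasurable_iUnion_iff]
  intro n
  refine (hf _ _ (by positivity) ?_).aestronglyMeasurable
  have h : 1 / ((n : ℝ) + 1) ≤ 1 := by
    rw [div_le_one (by positivity)]
    linarith [n.cast_nonneg (α := ℝ)]
  linarith [n.cast_nonneg (α := ℝ)]

/-- A real power of a weight is continuous on `(0, ∞)`. -/
theorem IsWeight.continuousOn_rpow {ω : ℝ → ℝ} (hω : IsWeight ω) (r : ℝ) :
    ContinuousOn (fun t => ω t ^ r) (Set.Ioi 0) :=
  hω.1.rpow_const fun t ht => Or.inl (hω.2 t ht).ne'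

/-- Membership in the weighted space `L^p(ω)` is membership of `f ω^{1/p}` in `L^p`. -/
theorem IsWeight.integrableOn_rpow_mul_iff_memLp {p : ℝ} {ω f : ℝ → ℝ} (hp : 1 < p)
    (hω : IsWeight ω) (hf : AEStronglyMeasurable f (volume.restrict (Set.Ioi 0))) :
    IntegrableOn (fun t => |f t| ^ p * ω t) (Set.Ioi 0) ↔
      MemLp (fun t => f t * ω t ^ (1 / p)) (ENNReal.ofReal p) (volume.restrict (Set.Ioi 0)) := by
  have hp0 : 0 < p := by linarith
  have hm : AEStronglyMeasurable (fun t => f t * ω t ^ (1 / p))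
      (volume.restrict (Set.Ioi 0)) := hf.mul ((hω.continuousOn_rpow (1 / p)).aestronglyMeasurable measurableSet_Ioi)
  rw [← integrable_norm_rpow_iff (p := ENNReal.ofReal p) hm (by simpa using hp0)
    ENNReal.ofReal_ne_top, ENNReal.toReal_ofReal hp0.le]
  refine integrable_congr ((ae_restrict_mem measurableSet_Ioi).mono fun t ht => ?_)
  have ht := hω.2 t ht
  simp only [norm_mul, Real.norm_eq_abs]
  rw [Real.mul_rpow (abs_nonneg _) (abs_nonneg _), abs_of_pos (Real.rpow_pos_of_pos ht _),
    ← Real.rpow_mul ht.le, one_div_mul_cancel hp0.ne', Real.rpow_one]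

/-- Near zero, `B_p(0)` controls `ω^{-1/(p-1)}` on every interval `(0, t]`. -/
theorem Bp0.integrableOn_Ioc {p : ℝ} {ω : ℝ → ℝ} (hB : Bp0 p ω) (hω : IsWeight ω) (t : ℝ) :
    IntegrableOn (fun s => ω s ^ (-1 / (p - 1))) (Set.Ioc 0 t) := by
  have h : IntegrableOn (fun s => ω s ^ (-1 / (p - 1))) (Set.Icc 1 t) :=
    ((hω.continuousOn_rpow _).mono fun s hs =>
      lt_of_lt_of_le one_pos hs.1).integrableOn_compact isCompact_Icc
  refine (IntegrableOn.union hB h).mono_set fun s hs => ?_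
  rcases le_total s 1 with h1 | h1
  · exact Or.inl ⟨hs.1, h1⟩
  · exact Or.inr ⟨h1, hs.2⟩

/-- Hölder's inequality on `(0, t]` for weights in `B_p(0)`. -/
theorem Bp0.integrableOn_and_integral_abs_le {p : ℝ} {ω f : ℝ → ℝ} (hB : Bp0 p ω) (hp : 1 < p)
    (hω : IsWeight ω) (hf : AEStronglyMeasurable f (volume.restrict (Set.Ioi 0)))
    (hfp : IntegrableOn (fun s => |f s| ^ p * ω s) (Set.Ioi 0)) (t : ℝ) :
    IntegrableOn f (Set.Ioc 0 t) ∧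
      ∫ s in Set.Ioc 0 t, |f s| ≤ dNorm p ω f * Omega0 p ω t := by
  have hp0 : 0 < p := by linarith
  have hp1 : p - 1 ≠ 0 := by linarith
  set q := p.conjExponent with hq
  have hpq : p.HolderConjugate q := Real.HolderConjugate.conjExponent hp
  have hq0 : 0 < q := hpq.symm.pos
  have hsub : Set.Ioc 0 t ⊆ Set.Ioi (0 : ℝ) := Set.Ioc_subset_Ioi_self
  have hmem : ∀ᵐ s ∂volume.restrict (Set.Ioc 0 t), 0 < ω s :=
    (ae_restrict_mem measurableSet_Ioc).mono fun s hs => hω.2 s hs.1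
  have hF : MemLp (fun s => f s * ω s ^ (1 / p)) (ENNReal.ofReal p)
      (volume.restrict (Set.Ioc 0 t)) :=
    ((hω.integrableOn_rpow_mul_iff_memLp hp hf).1 hfp).mono_measure
      (Measure.restrict_mono hsub le_rfl)
  have hGpow : (fun s => ‖ω s ^ (-(1 / p))‖ ^ q) =ᵐ[volume.restrict (Set.Ioc 0 t)]
      fun s => ω s ^ (-1 / (p - 1)) := by
    filter_upwards [hmem] with s hs
    rw [Real.norm_of_nonneg (Real.rpow_nonneg hs.le _), ← Real.rpow_mul hs.le]
    congr 1
    rw [hq, Real.conjExponent]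
    field_simp
  have hG : MemLp (fun s => ω s ^ (-(1 / p))) (ENNReal.ofReal q)
      (volume.restrict (Set.Ioc 0 t)) := by
    rw [← integrable_norm_rpow_iff (((hω.continuousOn_rpow _).mono hsub).aestronglyMeasurable
      measurableSet_Ioc) (by simpa using hq0) ENNReal.ofReal_ne_top, ENNReal.toReal_ofReal hq0.le]
    exact (hB.integrableOn_Ioc hω t).congr hGpow.symm
  have hmul : (fun s => f s * ω s ^ (1 / p) * ω s ^ (-(1 / p)))
      =ᵐ[volume.restrict (Set.Ioc 0 t)] f := by
    filter_upwards [hmem] with s hs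
    rw [mul_assoc, ← Real.rpow_add hs, add_neg_cancel, Real.rpow_zero, mul_one]
  have hconj : ENNReal.HolderConjugate (ENNReal.ofReal p) (ENNReal.ofReal q) := hpq.ennrealOfReal
  refine ⟨(hF.integrable_mul hG).congr hmul, ?_⟩
  have hH := integral_mul_norm_le_Lp_mul_Lq hpq hF hG
  have hL : ∫ s in Set.Ioc 0 t, ‖f s * ω s ^ (1 / p)‖ * ‖ω s ^ (-(1 / p))‖
      = ∫ s in Set.Ioc 0 t, |f s| :=
    integral_congr_ae (hmul.mono fun s hs => by
      simp only [Real.norm_eq_abs, ← abs_mul]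
      exact congrArg abs hs)
  have hFpow : ∫ s in Set.Ioc 0 t, ‖f s * ω s ^ (1 / p)‖ ^ p
      = ∫ s in Set.Ioc 0 t, |f s| ^ p * ω s := by
    refine integral_congr_ae (hmem.mono fun s hs => ?_)
    simp only [norm_mul, Real.norm_eq_abs]
    rw [Real.mul_rpow (abs_nonneg _) (abs_nonneg _), abs_of_pos (Real.rpow_pos_of_pos hs _),
      ← Real.rpow_mul hs.le, one_div_mul_cancel hp0.ne', Real.rpow_one]
  have hnn : ∀ s ∈ Set.Ioi (0 : ℝ), 0 ≤ |f s| ^ p * ω s := fun s hs =>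
    mul_nonneg (Real.rpow_nonneg (abs_nonneg _) _) (hω.2 s hs).le
  have hqinv : 1 / q = 1 - 1 / p := by
    rw [hq, Real.conjExponent]
    field_simp
  rw [hL, hFpow, integral_congr_ae hGpow, hqinv] at hH
  refine hH.trans (mul_le_mul_of_nonneg_right ?_ (Real.rpow_nonneg ?_ _))
  · refine Real.rpow_le_rpow (setIntegral_nonneg measurableSet_Ioc fun s hs => hnn s (hsub hs))
      (setIntegral_mono_set hfp ?_ hsub.eventuallyLE) (by positivity)
    exact (ae_restrict_mem measurableSet_Ioi).mono hnn
  · exact setIntegral_nonneg measurableSet_Ioc fun s hs =>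
      Real.rpow_nonneg (hω.2 s (hsub hs)).le _

/-- if `ω ∈ B_p(0)`, then `R^0_{p,ω}(c)` is a closed subset of
`D^{1,p}(ℝ₊,ω)`. -/
theorem stmt2 (p : ℝ) (ω : ℝ → ℝ) (hp : 1 < p) (hω : IsWeight ω)
    (hB : Bp0 p ω) (c : ℝ)
    (u : ℕ → ℝ → ℝ) (u' : ℕ → ℝ → ℝ) (v v' : ℝ → ℝ)
    (hn : ∀ n, MemR0 p ω c (u n) (u' n)) (hv : MemD p ω v v')
    (hLp : Tendsto (fun n => ∫ t in Set.Ioi (0:ℝ), |u' n t - v' t| ^ p * ω t)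
      atTop (𝓝 0))
    (hloc : ∀ K : Set ℝ, K ⊆ Set.Ioi 0 → IsCompact K →
      TendstoUniformlyOn (fun n => u n) v atTop K) :
    MemR0 p ω c v v' := by
  have hp0 : 0 < p := by linarith
  have hvm := aestronglyMeasurable_Ioi_of_integrableOn_Ioc hv.1
  have hum := fun n => aestronglyMeasurable_Ioi_of_integrableOn_Ioc (hn n).1.1
  have hdiff : ∀ n, IntegrableOn (fun s => |u' n s - v' s| ^ p * ω s) (Set.Ioi 0) := fun n => by
    have h := ((hω.integrableOn_rpow_mul_iff_memLp hp (hum n)).1 (hn n).1.2.2).sub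
      ((hω.integrableOn_rpow_mul_iff_memLp hp hvm).1 hv.2.2)
    refine (hω.integrableOn_rpow_mul_iff_memLp hp ((hum n).sub hvm)).2 ?_
    convert h using 1
    ext s
    simp [sub_mul]
  refine ⟨hv, fun t ht => ?_⟩
  have hvi := (hB.integrableOn_and_integral_abs_le hp hω hvm hv.2.2 t).1
  refine ⟨hvi, ?_⟩
  have hnorm : Tendsto (fun n => dNorm p ω (fun s => u' n s - v' s) * Omega0 p ω t)
      atTop (𝓝 0) := by
    have h := (hLp.rpow_const (p := 1 / p) (Or.inr (by positivity))).mul_const (Omega0 p ω t)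
    rwa [Real.zero_rpow (by positivity), zero_mul] at h
  have hint : Tendsto (fun n => ∫ s in Set.Ioc 0 t, u' n s) atTop
      (𝓝 (∫ s in Set.Ioc 0 t, v' s)) := by
    rw [tendsto_iff_norm_sub_tendsto_zero]
    refine squeeze_zero (fun n => norm_nonneg _) (fun n => ?_) hnorm
    rw [← integral_sub ((hn n).2 t ht).1 hvi]
    exact (norm_integral_le_integral_norm _).trans
      (hB.integrableOn_and_integral_abs_le hp hω ((hum n).sub hvm) (hdiff n) t).2
  have hpt : Tendsto (fun n => u n t) atTop (𝓝 (v t)) :=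
    (hloc {t} (by simpa using ht) isCompact_singleton).tendsto_at rfl
  exact tendsto_nhds_unique hpt
    ((hint.const_add c).congr fun n => ((hn n).2 t ht).2.symm)

end
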